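/- Let ρ ∈ [0,1] and let (S₁,S₂) be a bivariate Gaussian pair with correlation ρ (realized as S₁ = X, S₂ = ρX + √(1−ρ²)·W with X, W independent standard Gaussians). Then for all measurable functions g, h : ℝ → ℝ with E[g(S₁)] = E[h(S₂)] = 0 and E[g(S₁)²], E[h(S₂)²] < ∞, one has E[g(S₁)h(S₂)] ≤ ρ·√(E[g(S₁)²])·√(E[h(S₂)²]); moreover the supremum of E[g(S₁)h(S₂)] over all such g, h with E[g(S₁)²] = E[h(S₂)²] = 1 equals ρ. (Hirschfeld–Gebelein–Rényi maximal correlation of a bivariate Gaussian pair equals |ρ|.) -/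

import Mathlib

open MeasureTheory ProbabilityTheory

section MaxCorr
open scoped ENNReal NNReal InnerProductSpace

lemma mc_hasSum (ρ : ℝ) (c d : ℝ →₀ ℝ) :
    HasSum (fun n : ℕ => ρ ^ n * (∑ a ∈ c.support, c a * a ^ n) * (∑ b ∈ d.support, d b * b ^ n)
        / (n.factorial : ℝ))
      (∑ a ∈ c.support, ∑ b ∈ d.support, c a * d b * Real.exp (ρ * a * b)) := by
  have h : HasSum (fun n : ℕ => ∑ a ∈ c.support, ∑ b ∈ d.support,
      c a * d b * ((ρ * a * b) ^ n / (n.factorial : ℝ)))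
      (∑ a ∈ c.support, ∑ b ∈ d.support, c a * d b * Real.exp (ρ * a * b)) := by
    refine hasSum_sum fun a _ => hasSum_sum fun b _ => HasSum.mul_left _ ?_
    rw [Real.exp_eq_exp_ℝ]
    exact NormedSpace.expSeries_div_hasSum_exp (ρ * a * b)
  convert h using 2 with n
  rw [mul_assoc, Finset.sum_mul_sum, Finset.mul_sum, Finset.sum_div]
  refine Finset.sum_congr rfl fun a _ => ?_
  rw [Finset.mul_sum, Finset.sum_div]
  refine Finset.sum_congr rfl fun b _ => ?_
  rw [mul_pow, mul_pow]
  ring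

lemma mc_finite (ρ : ℝ) (h0 : 0 ≤ ρ) (h1 : ρ ≤ 1) (c d : ℝ →₀ ℝ) :
    2 * ((∑ a ∈ c.support, ∑ b ∈ d.support, c a * d b * Real.exp (ρ * a * b))
      - (∑ a ∈ c.support, c a) * (∑ b ∈ d.support, d b)) ≤
    ρ * ((∑ a ∈ c.support, ∑ b ∈ c.support, c a * c b * Real.exp (a * b)) +
      (∑ a ∈ d.support, ∑ b ∈ d.support, d a * d b * Real.exp (a * b))) := by
  have hcd := mc_hasSum ρ c d
  have hcc := mc_hasSum 1 c c
  have hdd := mc_hasSum 1 d d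
  simp only [one_mul, one_pow] at hcc hdd
  have hs : HasSum (fun n : ℕ => if n = 0 then
      (∑ a ∈ c.support, c a) * (∑ b ∈ d.support, d b) else 0)
      ((∑ a ∈ c.support, c a) * (∑ b ∈ d.support, d b)) := hasSum_ite_eq 0 _
  refine hasSum_le ?_ ((hcd.sub hs).mul_left 2) ((hcc.add hdd).mul_left ρ)
  intro n
  rcases Nat.eq_zero_or_pos n with rfl | hn
  · simp
    exact mul_nonneg h0 (add_nonneg (mul_self_nonneg _) (mul_self_nonneg _))
  · rw [if_neg hn.ne', sub_zero]
    set G := ∑ a ∈ c.support, c a * a ^ n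
    set H := ∑ a ∈ d.support, d a * a ^ n
    have hp : ρ ^ n ≤ ρ := pow_le_of_le_one h0 h1 hn.ne'
    have hp0 : 0 ≤ ρ ^ n := pow_nonneg h0 n
    rw [← add_div, ← mul_div_assoc, ← mul_div_assoc]
    refine div_le_div_of_nonneg_right ?_ (by positivity)
    nlinarith [mul_nonneg hp0 (sq_nonneg (G - H)),
      mul_nonneg (sub_nonneg.2 hp) (add_nonneg (sq_nonneg G) (sq_nonneg H))]

lemma mc_hilbert {E F : Type*} [NormedAddCommGroup E] [InnerProductSpace ℝ E]
    [NormedAddCommGroup F] [InnerProductSpace ℝ F]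
    (ρ : ℝ) (h0 : 0 ≤ ρ) (h1 : ρ ≤ 1) (e : ℝ → E) (A C : E →ₗᵢ[ℝ] F)
    (hd : (Submodule.span ℝ (Set.range e)).topologicalClosure = ⊤)
    (he : ∀ a b, ⟪e a, e b⟫_ℝ = Real.exp (a * b))
    (hAC : ∀ a b, ⟪A (e a), C (e b)⟫_ℝ = Real.exp (ρ * a * b)) (g h : E) :
    ⟪A g, C h⟫_ℝ - ⟪g, e 0⟫_ℝ * ⟪h, e 0⟫_ℝ ≤ ρ * ‖g‖ * ‖h‖ := by
  have key : ∀ g h : E, 2 * (⟪A g, C h⟫_ℝ - ⟪g, e 0⟫_ℝ * ⟪h, e 0⟫_ℝ) ≤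
      ρ * (⟪g, g⟫_ℝ + ⟪h, h⟫_ℝ) := by
    have hdense : Dense ((Submodule.span ℝ (Set.range e) : Submodule ℝ E) : Set E) :=
      Submodule.dense_iff_topologicalClosure_eq_top.2 hd
    have hA := A.continuous
    have hC := C.continuous
    intro g h
    have hcl : IsClosed {p : E × E | 2 * (⟪A p.1, C p.2⟫_ℝ - ⟪p.1, e 0⟫_ℝ * ⟪p.2, e 0⟫_ℝ) ≤
      ρ * (⟪p.1, p.1⟫_ℝ + ⟪p.2, p.2⟫_ℝ)} := isClosed_le (by fun_prop) (by fun_prop)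
    refine (hdense.prod hdense).induction (P := fun p : E × E =>
      2 * (⟪A p.1, C p.2⟫_ℝ - ⟪p.1, e 0⟫_ℝ * ⟪p.2, e 0⟫_ℝ) ≤
      ρ * (⟪p.1, p.1⟫_ℝ + ⟪p.2, p.2⟫_ℝ)) ?_ hcl (g, h)
    rintro ⟨g, h⟩ ⟨hg, hh⟩
    obtain ⟨c, rfl⟩ := Finsupp.mem_span_range_iff_exists_finsupp.1 hg
    obtain ⟨d, rfl⟩ := Finsupp.mem_span_range_iff_exists_finsupp.1 hh
    have := mc_finite ρ h0 h1 c d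
    simp only [Finsupp.sum, map_sum, map_smul, sum_inner, inner_sum, inner_smul_left,
      inner_smul_right, he, hAC, mul_zero, Real.exp_zero, mul_one, RCLike.conj_to_real]
    have sw : ∀ (c d : ℝ →₀ ℝ) (K : ℝ → ℝ → ℝ),
        ∑ x ∈ d.support, d x * ∑ y ∈ c.support, c y * K y x =
          ∑ y ∈ c.support, ∑ x ∈ d.support, c y * d x * K y x := fun c d K => by
      rw [Finset.sum_comm]
      refine Finset.sum_congr rfl fun x _ => ?_
      rw [Finset.mul_sum]
      refine Finset.sum_congr rfl fun y _ => ?_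
      ring
    rw [sw c d (fun y x => Real.exp (ρ * y * x)), sw c c (fun y x => Real.exp (y * x)),
      sw d d (fun y x => Real.exp (y * x))]
    exact this
  by_cases hg : g = 0
  · simp [hg]
  by_cases hh : h = 0
  · simp [hh]
  have hg' := norm_pos_iff.2 hg
  have hh' := norm_pos_iff.2 hh
  have := key (‖h‖ • g) (‖g‖ • h)
  simp only [map_smul, inner_smul_left, inner_smul_right, real_inner_self_eq_norm_sq,
    RCLike.conj_to_real] at this
  have hp : 0 < ‖g‖ * ‖h‖ := mul_pos hg' hh'
  refine le_of_mul_le_mul_left ?_ hp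
  nlinarith

lemma mc_ae_zero (f : ℝ → ℝ) (hm : Measurable f) (hf : MemLp f 2 (gaussianReal 0 1))
    (hz : ∀ a : ℝ, ∫ x, f x * Real.exp (a * x) ∂(gaussianReal 0 1) = 0) :
    f =ᵐ[gaussianReal 0 1] 0 := by
  have hexp : ∀ a : ℝ, MemLp (fun x => Real.exp (a * x)) 2 (gaussianReal 0 1) := fun a => by
    rw [memLp_two_iff_integrable_sq (by fun_prop)]
    refine (integrable_exp_mul_gaussianReal (2 * a)).congr (ae_of_all _ fun x => ?_)
    simp only [← Real.exp_nat_mul]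
    congr 1; push_cast; ring
  set p : ℝ → ℝ≥0 := fun x => (f x).toNNReal with hp
  set q : ℝ → ℝ≥0 := fun x => (-f x).toNNReal with hq
  have hpm : Measurable p := hm.real_toNNReal
  have hqm : Measurable q := hm.neg.real_toNNReal
  have hfi : ∀ a : ℝ, Integrable (fun x => f x * Real.exp (a * x)) (gaussianReal 0 1) :=
    fun a => hf.integrable_mul (hexp a)
  have hpi : ∀ a : ℝ, Integrable (fun x => p x • Real.exp (a * x)) (gaussianReal 0 1) := fun a => by
    refine (hfi a).mono (by fun_prop) (ae_of_all _ fun x => ?_)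
    simp only [hp, NNReal.smul_def, smul_eq_mul, norm_mul]
    gcongr
    simp only [Real.coe_toNNReal', Real.norm_eq_abs]
    rw [abs_of_nonneg (le_max_right _ _)]
    exact max_le (le_abs_self _) (abs_nonneg _)
  have hqi : ∀ a : ℝ, Integrable (fun x => q x • Real.exp (a * x)) (gaussianReal 0 1) := fun a => by
    refine (hfi a).mono (by fun_prop) (ae_of_all _ fun x => ?_)
    simp only [hq, NNReal.smul_def, smul_eq_mul, norm_mul]
    gcongr
    simp only [Real.coe_toNNReal', Real.norm_eq_abs]
    rw [abs_of_nonneg (le_max_right _ _)]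
    exact max_le (neg_le_abs _) (abs_nonneg _)
  set P := (gaussianReal 0 1).withDensity (fun x => (p x : ℝ≥0∞)) with hP
  set Q := (gaussianReal 0 1).withDensity (fun x => (q x : ℝ≥0∞)) with hQ
  have hPi : ∀ a : ℝ, Integrable (fun x => Real.exp (a * x)) P := fun a =>
    (integrable_withDensity_iff_integrable_smul hpm).2 (hpi a)
  have hQi : ∀ a : ℝ, Integrable (fun x => Real.exp (a * x)) Q := fun a =>
    (integrable_withDensity_iff_integrable_smul hqm).2 (hqi a)
  have hPf : IsFiniteMeasure P := by
    have := hPi 0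
    simp only [zero_mul, Real.exp_zero] at this
    exact (integrable_const_iff_isFiniteMeasure (one_ne_zero (α := ℝ))).1 this
  have hQf : IsFiniteMeasure Q := by
    have := hQi 0
    simp only [zero_mul, Real.exp_zero] at this
    exact (integrable_const_iff_isFiniteMeasure (one_ne_zero (α := ℝ))).1 this
  have hmgf : mgf id P = mgf id Q := by
    funext a
    simp only [mgf, id, hP, hQ]
    rw [integral_withDensity_eq_integral_smul hpm, integral_withDensity_eq_integral_smul hqm,
      ← sub_eq_zero, ← integral_sub (hpi a) (hqi a)]
    refine Eq.trans ?_ (hz a)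
    refine integral_congr_ae (ae_of_all _ fun x => ?_)
    simp only [hp, hq, NNReal.smul_def, smul_eq_mul, Real.coe_toNNReal']
    rw [← sub_mul]
    congr 1
    rcases le_total 0 (f x) with h | h
    · simp [h]
    · simp [h]
  have hPQ0 : P = 0 ↔ Q = 0 := by
    have := congrFun hmgf 0
    simp only [mgf_zero', measureReal_def] at this
    rw [← Measure.measure_univ_eq_zero, ← Measure.measure_univ_eq_zero,
      ← ENNReal.toReal_eq_toReal_iff' (measure_ne_top _ _) (by simp), this,
      ENNReal.toReal_eq_toReal_iff' (measure_ne_top _ _) (by simp)]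
  have hset : integrableExpSet id P = Set.univ := by
    ext a
    simpa [integrableExpSet] using hPi a
  have hPQ : P = Q := by
    apply Measure.ext_of_complexMGF_id_eq
    funext z
    exact eqOn_complexMGF_of_mgf' hmgf hPQ0 (by simp [hset])
  have := (withDensity_eq_iff_of_sigmaFinite (by fun_prop) (by fun_prop)).1 hPQ
  filter_upwards [this] with x hx
  simp only [hp, hq, ENNReal.coe_inj] at hx
  have hx' := congrArg NNReal.toReal hx
  simp only [Real.coe_toNNReal'] at hx'
  rcases le_total 0 (f x) with h | h
  · simpa [h] using hx'
  · simpa [h] using hx'.symm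

lemma mc_int_exp (a : ℝ) : ∫ x, Real.exp (a * x) ∂(gaussianReal 0 1) = Real.exp (a ^ 2 / 2) := by
  have := congrFun (mgf_id_gaussianReal (μ := 0) (v := 1)) a
  simpa [mgf] using this

lemma mc_memLp (a : ℝ) :
    MemLp (fun x => Real.exp (a * x - a ^ 2 / 2)) 2 (gaussianReal 0 1) := by
  rw [memLp_two_iff_integrable_sq (by fun_prop)]
  refine ((integrable_exp_mul_gaussianReal (2 * a)).mul_const (Real.exp (-a^2))).congr
    (ae_of_all _ fun x => ?_)
  simp only [← Real.exp_nat_mul, ← Real.exp_add]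
  congr 1; push_cast; ring

noncomputable def mcE (a : ℝ) : Lp ℝ 2 (gaussianReal 0 1) := (mc_memLp a).toLp _

lemma mc_dense : (Submodule.span ℝ (Set.range mcE)).topologicalClosure = ⊤ := by
  rw [Submodule.topologicalClosure_eq_top_iff, Submodule.eq_bot_iff]
  intro f hf
  rw [Submodule.mem_orthogonal] at hf
  have hf' : ∀ a, ⟪mcE a, f⟫_ℝ = 0 := fun a => hf _ (Submodule.subset_span ⟨a, rfl⟩)
  rw [Lp.eq_zero_iff_ae_eq_zero]
  refine mc_ae_zero f (Lp.stronglyMeasurable f).measurable (Lp.memLp f) fun a => ?_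
  have h := hf' a
  rw [L2.inner_def] at h
  have h2 : ∫ x, ⟪mcE a x, f x⟫_ℝ ∂(gaussianReal 0 1) =
      ∫ x, Real.exp (-a^2/2) * (f x * Real.exp (a * x)) ∂(gaussianReal 0 1) := by
    refine integral_congr_ae ?_
    filter_upwards [(mc_memLp a).coeFn_toLp] with x hx
    rw [mcE, hx]
    simp only [RCLike.inner_apply, conj_trivial]
    rw [mul_left_comm, ← Real.exp_add]
    ring_nf
  rw [h2, integral_const_mul] at h
  exact (mul_eq_zero.1 h).resolve_left (Real.exp_pos _).ne'

lemma mc_inner_toLp {α : Type*} [MeasurableSpace α] {ν : Measure α} {f g : α → ℝ}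
    (hf : MemLp f 2 ν) (hg : MemLp g 2 ν) :
    ⟪hf.toLp f, hg.toLp g⟫_ℝ = ∫ x, f x * g x ∂ν := by
  rw [L2.inner_def]
  refine integral_congr_ae ?_
  filter_upwards [hf.coeFn_toLp, hg.coeFn_toLp] with x hx hy
  rw [hx, hy]
  simp [mul_comm]

lemma mc_inner (a b : ℝ) : ⟪mcE a, mcE b⟫_ℝ = Real.exp (a * b) := by
  rw [mcE, mcE, mc_inner_toLp]
  have : ∀ x : ℝ, Real.exp (a * x - a ^ 2 / 2) * Real.exp (b * x - b ^ 2 / 2) =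
      Real.exp ((a + b) * x) * Real.exp (-(a ^ 2 + b ^ 2) / 2) := fun x => by
    rw [← Real.exp_add, ← Real.exp_add]; ring_nf
  simp only [this]
  rw [integral_mul_const, mc_int_exp, ← Real.exp_add]
  ring_nf

lemma mc_preserving (ρ : ℝ) (h0 : 0 ≤ ρ) (h1 : ρ ≤ 1) :
    MeasurePreserving (fun p : ℝ × ℝ => ρ * p.1 + Real.sqrt (1 - ρ ^ 2) * p.2)
      ((gaussianReal 0 1).prod (gaussianReal 0 1)) (gaussianReal 0 1) := by
  refine ⟨by fun_prop, ?_⟩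
  have hi : IndepFun (fun p : ℝ × ℝ => ρ * p.1) (fun p : ℝ × ℝ => Real.sqrt (1 - ρ ^ 2) * p.2)
      ((gaussianReal 0 1).prod (gaussianReal 0 1)) :=
    indepFun_prod (X := fun x => ρ * x) (Y := fun x => Real.sqrt (1 - ρ ^ 2) * x)
      (by fun_prop) (by fun_prop)
  have hl : ((gaussianReal 0 1).prod (gaussianReal 0 1)).map Prod.fst = gaussianReal 0 1 := by
    simp
  have hr : ((gaussianReal 0 1).prod (gaussianReal 0 1)).map Prod.snd = gaussianReal 0 1 := by
    simp
  have ha := gaussianReal_const_mul (X := (Prod.fst : ℝ × ℝ → ℝ)) ⟨by fun_prop, hl⟩ ρ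
  have hb := gaussianReal_const_mul (X := (Prod.snd : ℝ × ℝ → ℝ)) ⟨by fun_prop, hr⟩
    (Real.sqrt (1 - ρ ^ 2))
  have := gaussianReal_add_gaussianReal_of_indepFun hi ha.map_eq hb.map_eq
  convert this using 2
  · rfl
  · simp
  · apply NNReal.eq
    simp
    rw [Real.sq_sqrt (by nlinarith)]
    ring

lemma mc_core (ρ : ℝ) (h0 : 0 ≤ ρ) (h1 : ρ ≤ 1) (g h : ℝ → ℝ)
    (hg : MemLp g 2 (gaussianReal 0 1)) (hh : MemLp h 2 (gaussianReal 0 1))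
    (hg0 : ∫ x, g x ∂(gaussianReal 0 1) = 0) :
    ∫ p : ℝ × ℝ, g p.1 * h (ρ * p.1 + Real.sqrt (1 - ρ ^ 2) * p.2)
      ∂((gaussianReal 0 1).prod (gaussianReal 0 1)) ≤
    ρ * Real.sqrt (∫ x, g x ^ 2 ∂(gaussianReal 0 1)) *
      Real.sqrt (∫ x, h x ^ 2 ∂(gaussianReal 0 1)) := by
  have hfst : MeasurePreserving (Prod.fst : ℝ × ℝ → ℝ)
      ((gaussianReal 0 1).prod (gaussianReal 0 1)) (gaussianReal 0 1) := measurePreserving_fst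
  have hS := mc_preserving ρ h0 h1
  have hn : ∀ (f : ℝ → ℝ) (hf : MemLp f 2 (gaussianReal 0 1)),
      ‖hf.toLp f‖ = Real.sqrt (∫ x, f x ^ 2 ∂(gaussianReal 0 1)) := fun f hf => by
    rw [norm_eq_sqrt_real_inner, mc_inner_toLp]
    simp only [sq]
  have hAC : ∀ (f k : ℝ → ℝ) (hf : MemLp f 2 (gaussianReal 0 1))
      (hk : MemLp k 2 (gaussianReal 0 1)),
      ⟪Lp.compMeasurePreservingₗᵢ ℝ _ hfst (hf.toLp f),
        Lp.compMeasurePreservingₗᵢ ℝ _ hS (hk.toLp k)⟫_ℝ =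
      ∫ p : ℝ × ℝ, f p.1 * k (ρ * p.1 + Real.sqrt (1 - ρ ^ 2) * p.2)
      ∂((gaussianReal 0 1).prod (gaussianReal 0 1)) := fun f k hf hk =>
    mc_inner_toLp (hf.comp_measurePreserving hfst) (hk.comp_measurePreserving hS)
  have := mc_hilbert ρ h0 h1 mcE (Lp.compMeasurePreservingₗᵢ ℝ _ hfst)
    (Lp.compMeasurePreservingₗᵢ ℝ _ hS) mc_dense mc_inner (fun a b => ?_) (hg.toLp g) (hh.toLp h)
  · rw [hAC, hn, hn] at this
    have hz : ⟪hg.toLp g, mcE 0⟫_ℝ = 0 := by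
      rw [mcE, mc_inner_toLp]
      simpa using hg0
    rwa [hz, zero_mul, sub_zero] at this
  · rw [mcE, mcE, hAC]
    have : ∀ p : ℝ × ℝ, Real.exp (a * p.1 - a ^ 2 / 2) *
        Real.exp (b * (ρ * p.1 + Real.sqrt (1 - ρ ^ 2) * p.2) - b ^ 2 / 2) =
        (Real.exp ((a + b * ρ) * p.1) * Real.exp ((b * Real.sqrt (1 - ρ ^ 2)) * p.2)) *
          Real.exp (-(a ^ 2 + b ^ 2) / 2) := fun p => by
      rw [← Real.exp_add, ← Real.exp_add, ← Real.exp_add]; ring_nf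
    simp only [this]
    rw [integral_mul_const, integral_prod_mul (fun x => Real.exp ((a + b * ρ) * x))
      (fun x => Real.exp ((b * Real.sqrt (1 - ρ ^ 2)) * x)), mc_int_exp, mc_int_exp,
      ← Real.exp_add, ← Real.exp_add, mul_pow, Real.sq_sqrt (by nlinarith)]
    ring_nf

end MaxCorr


/-- Hirschfeld–Gebelein–Rényi maximal correlation of a bivariate Gaussian pair:
for `(S₁,S₂)` jointly Gaussian with unit variances and correlation `ρ ∈ [0,1]`
(realized as `S₁ = X`, `S₂ = ρX + √(1−ρ²)W` with `X, W` independent standard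
Gaussians), every pair of zero-mean square-integrable functions `g, h` satisfies
`E[g(S₁)h(S₂)] ≤ ρ√(E[g(S₁)²])√(E[h(S₂)²])`, and the supremum of `E[g(S₁)h(S₂)]`
over such `g, h` with unit second moments equals `ρ`. -/
theorem maximal_correlation_bivariate_gaussian
    {Ω : Type*} [MeasurableSpace Ω] (μ : Measure Ω) [IsProbabilityMeasure μ]
    (ρ : ℝ) (hρ : ρ ∈ Set.Icc (0:ℝ) 1)
    (X W : Ω → ℝ)
    (hX : μ.map X = gaussianReal 0 1)
    (hW : μ.map W = gaussianReal 0 1)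
    (hindep : IndepFun X W μ)
    (S₁ S₂ : Ω → ℝ)
    (hS₁ : S₁ = X)
    (hS₂ : S₂ = fun ω => ρ * X ω + Real.sqrt (1 - ρ ^ 2) * W ω) :
    (∀ g h : ℝ → ℝ, Measurable g → Measurable h →
        (∫ ω, g (S₁ ω) ∂μ) = 0 → (∫ ω, h (S₂ ω) ∂μ) = 0 →
        Integrable (fun ω => g (S₁ ω) ^ 2) μ →
        Integrable (fun ω => h (S₂ ω) ^ 2) μ →
        (∫ ω, g (S₁ ω) * h (S₂ ω) ∂μ) ≤
          ρ * Real.sqrt (∫ ω, g (S₁ ω) ^ 2 ∂μ) *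
            Real.sqrt (∫ ω, h (S₂ ω) ^ 2 ∂μ)) ∧
    sSup {x : ℝ | ∃ g h : ℝ → ℝ, Measurable g ∧ Measurable h ∧
        (∫ ω, g (S₁ ω) ∂μ) = 0 ∧ (∫ ω, h (S₂ ω) ∂μ) = 0 ∧
        Integrable (fun ω => g (S₁ ω) ^ 2) μ ∧
        Integrable (fun ω => h (S₂ ω) ^ 2) μ ∧
        (∫ ω, g (S₁ ω) ^ 2 ∂μ) = 1 ∧ (∫ ω, h (S₂ ω) ^ 2 ∂μ) = 1 ∧
        x = ∫ ω, g (S₁ ω) * h (S₂ ω) ∂μ} = ρ := by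
  have h0 := hρ.1
  have h1 := hρ.2
  have hXm : AEMeasurable X μ := aemeasurable_of_map_neZero (by rw [hX]; infer_instance)
  have hWm : AEMeasurable W μ := aemeasurable_of_map_neZero (by rw [hW]; infer_instance)
  have hlaw : μ.map (fun ω => (X ω, W ω)) = (gaussianReal 0 1).prod (gaussianReal 0 1) := by
    rw [(indepFun_iff_map_prod_eq_prod_map_map hXm hWm).1 hindep, hX, hW]
  have hXWm : AEMeasurable (fun ω => (X ω, W ω)) μ := hXm.prodMk hWm
  have hS := mc_preserving ρ h0 h1
  subst hS₁
  have hS₂m : AEMeasurable S₂ μ := by rw [hS₂]; fun_prop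
  have hS₂law : μ.map S₂ = gaussianReal 0 1 := by
    rw [← hS.map_eq, ← hlaw, AEMeasurable.map_map_of_aemeasurable (by fun_prop) hXWm, hS₂]
    rfl
  have int1 : ∀ f : ℝ → ℝ, Measurable f → ∫ ω, f (S₁ ω) ∂μ = ∫ x, f x ∂(gaussianReal 0 1) :=
    fun f hf => by rw [← hX, integral_map hXm hf.aestronglyMeasurable]
  have int2 : ∀ f : ℝ → ℝ, Measurable f → ∫ ω, f (S₂ ω) ∂μ = ∫ x, f x ∂(gaussianReal 0 1) :=
    fun f hf => by rw [← hS₂law, integral_map hS₂m hf.aestronglyMeasurable]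
  have iff1 : ∀ f : ℝ → ℝ, Measurable f →
      (Integrable (fun ω => f (S₁ ω) ^ 2) μ ↔ MemLp f 2 (gaussianReal 0 1)) := fun f hf => by
    rw [memLp_two_iff_integrable_sq hf.aestronglyMeasurable, ← hX,
      integrable_map_measure (by fun_prop) hXm]
    rfl
  have iff2 : ∀ f : ℝ → ℝ, Measurable f →
      (Integrable (fun ω => f (S₂ ω) ^ 2) μ ↔ MemLp f 2 (gaussianReal 0 1)) := fun f hf => by
    rw [memLp_two_iff_integrable_sq hf.aestronglyMeasurable, ← hS₂law,
      integrable_map_measure (by fun_prop) hS₂m]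
    rfl
  have int12 : ∀ g h : ℝ → ℝ, Measurable g → Measurable h →
      ∫ ω, g (S₁ ω) * h (S₂ ω) ∂μ =
        ∫ p : ℝ × ℝ, g p.1 * h (ρ * p.1 + Real.sqrt (1 - ρ ^ 2) * p.2)
          ∂((gaussianReal 0 1).prod (gaussianReal 0 1)) := fun g h hg hh => by
    rw [← hlaw, integral_map hXWm (Measurable.aestronglyMeasurable (by fun_prop)), hS₂]
  have main : ∀ g h : ℝ → ℝ, Measurable g → Measurable h →
        (∫ ω, g (S₁ ω) ∂μ) = 0 → (∫ ω, h (S₂ ω) ∂μ) = 0 →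
        Integrable (fun ω => g (S₁ ω) ^ 2) μ →
        Integrable (fun ω => h (S₂ ω) ^ 2) μ →
        (∫ ω, g (S₁ ω) * h (S₂ ω) ∂μ) ≤
          ρ * Real.sqrt (∫ ω, g (S₁ ω) ^ 2 ∂μ) *
            Real.sqrt (∫ ω, h (S₂ ω) ^ 2 ∂μ) := by
    intro g h hg hh hg0 hh0 hgi hhi
    rw [int12 g h hg hh, int1 (fun x => g x ^ 2) (by fun_prop),
      int2 (fun x => h x ^ 2) (by fun_prop)]
    exact mc_core ρ h0 h1 g h ((iff1 g hg).1 hgi) ((iff2 h hh).1 hhi) (by rw [← int1 g hg, hg0])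
  refine ⟨main, IsGreatest.csSup_eq ⟨?_, ?_⟩⟩
  · have hid : MemLp (fun x : ℝ => x) 2 (gaussianReal 0 1) := memLp_id_gaussianReal' 2 (by simp)
    have hmean : ∫ x, x ∂(gaussianReal 0 1) = 0 := integral_id_gaussianReal
    have hsq : ∫ x, x ^ 2 ∂(gaussianReal 0 1) = 1 := by
      have h := variance_fun_id_gaussianReal (μ := 0) (v := 1)
      rw [variance_of_integral_eq_zero (by fun_prop) hmean] at h
      simpa using h
    refine ⟨fun x => x, fun x => x, measurable_id, measurable_id, ?_, ?_, ?_, ?_, ?_, ?_, ?_⟩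
    · rw [int1 (fun x => x) measurable_id, hmean]
    · rw [int2 (fun x => x) measurable_id, hmean]
    · exact (iff1 (fun x => x) measurable_id).2 hid
    · exact (iff2 (fun x => x) measurable_id).2 hid
    · rw [int1 (fun x => x ^ 2) (by fun_prop), hsq]
    · rw [int2 (fun x => x ^ 2) (by fun_prop), hsq]
    · rw [int12 (fun x => x) (fun x => x) measurable_id measurable_id]
      have hi2 : Integrable (fun x : ℝ => x ^ 2) (gaussianReal 0 1) := hid.integrable_sq
      have hi1 : Integrable (fun x : ℝ => x) (gaussianReal 0 1) := hid.integrable (by norm_num)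
      have e : ∀ p : ℝ × ℝ, p.1 * (ρ * p.1 + Real.sqrt (1 - ρ ^ 2) * p.2) =
          ρ * (p.1 ^ 2 * 1) + Real.sqrt (1 - ρ ^ 2) * (p.1 * p.2) := fun p => by ring
      simp only [e]
      rw [integral_add, integral_const_mul, integral_const_mul,
        integral_prod_mul (fun x : ℝ => x ^ 2) (fun _ : ℝ => (1 : ℝ)),
        integral_prod_mul (fun x : ℝ => x) (fun x : ℝ => x), hsq, hmean]
      · simp
      · exact (hi2.mul_prod (integrable_const (1 : ℝ))).const_mul ρ
      · exact (hi1.mul_prod hi1).const_mul _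
  · rintro x ⟨g, h, hg, hh, hg0, hh0, hgi, hhi, hg1, hh1, rfl⟩
    have := main g h hg hh hg0 hh0 hgi hhi
    simpa [hg1, hh1] using this
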